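/- Let n ≥ 2, d ∈ ℕ, and let X be uniformly distributed on the Euclidean ball of radius √(n+2) centered at the origin in ℝⁿ. Fix an integer i with 0 ≤ i < d/2, let g be a harmonic homogeneous polynomial of degree d−2i on ℝⁿ, and set f(x) = ‖x‖₂^{2i}·g(x) (a homogeneous polynomial of degree d). Then for every homogeneous polynomial h of degree d on ℝⁿ, E[f(X)h(X)] − E[f(X)]·E[h(X)] = η_i · ⟨f,h⟩_B, where η_i = (n+2)^d · (n/(n+2d)) · (2^i · i! · Π_{j=0}^{d−i−1}(n+2j))^{−1}. -/

import Mathlib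

open MeasureTheory

/-- A multivariate polynomial is harmonic if its Laplacian (the sum of its second formal
partial derivatives) vanishes. -/
def IsHarmonic {n : ℕ} (f : MvPolynomial (Fin n) ℝ) : Prop :=
  ∑ j, MvPolynomial.pderiv j (MvPolynomial.pderiv j f) = 0

/-- The Bombieri inner product of two homogeneous polynomials of degree `d`:
`⟨f,g⟩_B = ∑_{|I|=d} I! a_I b_I`. -/
noncomputable def bombieri {n : ℕ} (f g : MvPolynomial (Fin n) ℝ) : ℝ :=
  ∑ m ∈ f.support, (∏ i, ((m i).factorial : ℝ)) * f.coeff m * g.coeff m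

/-- The uniform (normalized Lebesgue) probability measure on a set `s ⊆ ℝⁿ`. -/
noncomputable def unif {n : ℕ} (s : Set (Fin n → ℝ)) : Measure (Fin n → ℝ) :=
  (volume s)⁻¹ • volume.restrict s

/-- The isotropic Euclidean ball: radius `√(n+2)`, centered at the origin of `ℝⁿ`. -/
def isoBall (n : ℕ) : Set (Fin n → ℝ) :=
  {x | ∑ i, (x i) ^ 2 ≤ (n : ℝ) + 2}

/-- The squared Euclidean norm as a polynomial. -/
noncomputable abbrev normSqPoly (n : ℕ) : MvPolynomial (Fin n) ℝ :=
  ∑ j : Fin n, MvPolynomial.X j ^ 2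

section Bombieri

open MvPolynomial

variable {n : ℕ}

lemma bombieri_add_left (f₁ f₂ h : MvPolynomial (Fin n) ℝ) :
    bombieri (f₁ + f₂) h = bombieri f₁ h + bombieri f₂ h :=
  Finsupp.sum_add_index'
    (h := fun m a => (∏ i, ((m i).factorial : ℝ)) * a * h.coeff m)
    (fun _ => by simp) (fun _ _ _ => by ring)

lemma bombieri_monomial_left (m : Fin n →₀ ℕ) (a : ℝ) (h : MvPolynomial (Fin n) ℝ) :
    bombieri (monomial m a) h = (∏ i, ((m i).factorial : ℝ)) * a * h.coeff m :=
  Finsupp.sum_single_index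
    (h := fun m a => (∏ i, ((m i).factorial : ℝ)) * a * h.coeff m) (by simp)

lemma bombieri_add_right (f h₁ h₂ : MvPolynomial (Fin n) ℝ) :
    bombieri f (h₁ + h₂) = bombieri f h₁ + bombieri f h₂ := by
  simp [bombieri, mul_add, Finset.sum_add_distrib]

lemma bombieri_smul_left (c : ℝ) (f h : MvPolynomial (Fin n) ℝ) :
    bombieri (c • f) h = c * bombieri f h := by
  induction f using MvPolynomial.induction_on' with
  | monomial m a => rw [smul_monomial, bombieri_monomial_left, bombieri_monomial_left]; simp; ring
  | add p q hp hq => rw [smul_add, bombieri_add_left, bombieri_add_left, hp, hq, mul_add]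

lemma bombieri_sum_left {ι : Type*} (s : Finset ι) (f : ι → MvPolynomial (Fin n) ℝ)
    (h : MvPolynomial (Fin n) ℝ) :
    bombieri (∑ j ∈ s, f j) h = ∑ j ∈ s, bombieri (f j) h :=
  map_sum (AddMonoidHom.mk' (fun f => bombieri f h) fun f₁ f₂ => bombieri_add_left f₁ f₂ h) f s

lemma bombieri_sum_right {ι : Type*} (s : Finset ι) (f : MvPolynomial (Fin n) ℝ)
    (h : ι → MvPolynomial (Fin n) ℝ) :
    bombieri f (∑ j ∈ s, h j) = ∑ j ∈ s, bombieri f (h j) :=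
  map_sum (AddMonoidHom.mk' (bombieri f) (bombieri_add_right f)) h s

/-- Multiplication by `X j` and `∂/∂x_j` are adjoint for the Bombieri inner product. -/
lemma bombieri_X_mul (j : Fin n) (f h : MvPolynomial (Fin n) ℝ) :
    bombieri (X j * f) h = bombieri f (pderiv j h) := by
  induction f using MvPolynomial.induction_on' with
  | monomial m a =>
    have hfac : (∏ i, (((m + Finsupp.single j 1 : Fin n →₀ ℕ) i).factorial : ℝ)) =
        (m j + 1) * ∏ i, ((m i).factorial : ℝ) := by
      rw [← Finset.mul_prod_erase _ _ (Finset.mem_univ j),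
        ← Finset.mul_prod_erase _ (fun i => ((m i).factorial : ℝ)) (Finset.mem_univ j)]
      have : ∀ i ∈ Finset.univ.erase j,
          (((m + Finsupp.single j 1 : Fin n →₀ ℕ) i).factorial : ℝ) = ((m i).factorial : ℝ) := by
        intro i hi
        simp [Finsupp.single_eq_of_ne (Finset.ne_of_mem_erase hi)]
      rw [Finset.prod_congr rfl this]
      simp [Nat.factorial_succ]
      ring
    rw [X, monomial_mul, bombieri_monomial_left, bombieri_monomial_left, coeff_pderiv,
      add_comm (Finsupp.single j 1) m, hfac]
    ring
  | add p q hp hq => rw [mul_add, bombieri_add_left, bombieri_add_left, hp, hq]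

lemma bombieri_normSqPoly_mul (f h : MvPolynomial (Fin n) ℝ) :
    bombieri (normSqPoly n * f) h = bombieri f (∑ j, pderiv j (pderiv j h)) := by
  simp_rw [normSqPoly, Finset.sum_mul, bombieri_sum_left, bombieri_sum_right, pow_two, mul_assoc,
    bombieri_X_mul]

end Bombieri

section GaussianFunctional

open MvPolynomial

variable {n : ℕ}

lemma pderiv_pderiv_comm (j k : Fin n) (p : MvPolynomial (Fin n) ℝ) :
    pderiv j (pderiv k p) = pderiv k (pderiv j p) := by
  ext m
  rcases eq_or_ne j k with rfl | hjk
  · rfl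
  · simp only [coeff_pderiv, Finsupp.add_apply, Finsupp.single_eq_of_ne hjk,
      Finsupp.single_eq_of_ne hjk.symm, add_right_comm m (Finsupp.single j 1)]
    push_cast
    ring

lemma IsHarmonic.pderiv {g : MvPolynomial (Fin n) ℝ} (hg : IsHarmonic g) (k : Fin n) :
    IsHarmonic (pderiv k g) := by
  have h := congrArg (MvPolynomial.pderiv k) hg
  rw [map_sum, map_zero] at h
  rw [IsHarmonic, ← h]
  refine Finset.sum_congr rfl fun j _ => ?_
  rw [pderiv_pderiv_comm j k g, pderiv_pderiv_comm j k]

lemma pderiv_eq_zero_of_isHomogeneous_zero {p : MvPolynomial (Fin n) ℝ} (hp : p.IsHomogeneous 0)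
    (j : Fin n) : pderiv j p = 0 := by
  rw [totalDegree_eq_zero_iff_eq_C.mp (Nat.le_zero.mp hp.totalDegree_le), pderiv_C]

lemma MvPolynomial.IsHomogeneous.laplacian {p : MvPolynomial (Fin n) ℝ} {m : ℕ}
    (hp : p.IsHomogeneous m) : (∑ j, MvPolynomial.pderiv j (MvPolynomial.pderiv j p)).IsHomogeneous
      (m - 2) :=
  IsHomogeneous.sum _ _ _ fun _ _ => hp.pderiv.pderiv

variable {L : MvPolynomial (Fin n) ℝ →ₗ[ℝ] ℝ}

lemma map_normSqPoly_mul (hL : ∀ j p, L (X j * p) = L (pderiv j p))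
    {p : MvPolynomial (Fin n) ℝ} {m : ℕ} (hp : p.IsHomogeneous m) :
    L (normSqPoly n * p) = (n + m) * L p := by
  have h1 : ∀ j : Fin n, L (X j ^ 2 * p) = L p + L (X j * pderiv j p) := fun j => by
    rw [pow_two, mul_assoc, hL, pderiv_mul, pderiv_X_self, one_mul, map_add]
  rw [normSqPoly, Finset.sum_mul, map_sum, Finset.sum_congr rfl fun j _ => h1 j,
    Finset.sum_add_distrib, ← map_sum L fun j => X j * pderiv j p, hp.sum_X_mul_pderiv,
    map_nsmul, nsmul_eq_mul]
  simp
  ring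

lemma isHomogeneous_normSqPoly : (normSqPoly n).IsHomogeneous 2 :=
  IsHomogeneous.sum _ _ _ fun j _ => by simpa using (isHomogeneous_X ℝ j).pow 2

lemma map_normSqPoly_pow_mul (hL : ∀ j p, L (X j * p) = L (pderiv j p))
    {p : MvPolynomial (Fin n) ℝ} {m : ℕ} (hp : p.IsHomogeneous m) (i : ℕ) :
    L (normSqPoly n ^ i * p) = (∏ k ∈ Finset.range i, ((n : ℝ) + (m + 2 * k))) * L p := by
  induction i with
  | zero => simp
  | succ i ih =>
    have hi : (normSqPoly n ^ i * p).IsHomogeneous (2 * i + m) :=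
      (isHomogeneous_normSqPoly.pow i).mul hp
    rw [pow_succ', mul_assoc, map_normSqPoly_mul hL hi, ih, Finset.prod_range_succ]
    push_cast
    ring

/-- Euler's identity followed by integration by parts. -/
lemma degree_mul_map_mul (hL : ∀ j p, L (X j * p) = L (pderiv j p))
    (g : MvPolynomial (Fin n) ℝ) {h : MvPolynomial (Fin n) ℝ} {e : ℕ} (hh : h.IsHomogeneous e) :
    (e : ℝ) * L (g * h) =
      ∑ j, L (pderiv j g * pderiv j h) + L (g * ∑ j, pderiv j (pderiv j h)) := by
  have h1 : (e : ℝ) * L (g * h) = L (g * ∑ j, X j * pderiv j h) := by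
    rw [hh.sum_X_mul_pderiv, mul_smul_comm, map_nsmul, nsmul_eq_mul]
  rw [h1, Finset.mul_sum, Finset.mul_sum, map_sum, map_sum, ← Finset.sum_add_distrib]
  refine Finset.sum_congr rfl fun j _ => ?_
  rw [mul_left_comm, hL, pderiv_mul, map_add]

/-- A harmonic polynomial is orthogonal to all polynomials of lower degree. -/
lemma map_harmonic_mul_eq_zero (hL : ∀ j p, L (X j * p) = L (pderiv j p)) (e : ℕ) :
    ∀ (m : ℕ) (g h : MvPolynomial (Fin n) ℝ), e < m → g.IsHomogeneous m → IsHarmonic g →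
      h.IsHomogeneous e → L (g * h) = 0 := by
  induction e using Nat.strong_induction_on with
  | _ e ih =>
    intro m g h hem hg hgh hh
    rcases Nat.eq_zero_or_pos e with rfl | he
    · have key := degree_mul_map_mul hL h hg
      have hlap : ∑ j, pderiv j (pderiv j g) = 0 := hgh
      simp only [pderiv_eq_zero_of_isHomogeneous_zero hh, hlap, zero_mul, mul_zero, map_zero,
        Finset.sum_const_zero, add_zero] at key
      rw [mul_comm]
      exact (mul_eq_zero.mp key).resolve_left (by exact_mod_cast hem.ne')
    · have key := degree_mul_map_mul hL g hh
      rw [Finset.sum_eq_zero fun j _ => ih (e - 1) (by omega) (m - 1) _ _ (by omega)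
        hg.pderiv (hgh.pderiv j) hh.pderiv, zero_add] at key
      rw [ih (e - 2) (by omega) m g _ (by omega) hg hgh hh.laplacian] at key
      exact (mul_eq_zero.mp key).resolve_left (by exact_mod_cast he.ne')

lemma map_harmonic_mul (hL : ∀ j p, L (X j * p) = L (pderiv j p)) (e : ℕ) :
    ∀ (m i : ℕ) (g h : MvPolynomial (Fin n) ℝ), m + 2 * i = e → g.IsHomogeneous m →
      IsHarmonic g → h.IsHomogeneous e →
      2 ^ i * (i.factorial : ℝ) * L (g * h) = L 1 * bombieri (normSqPoly n ^ i * g) h := by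
  induction e using Nat.strong_induction_on with
  | _ e ih =>
    intro m i g h hmi hg hgh hh
    rcases Nat.eq_zero_or_pos e with rfl | he
    · obtain rfl : m = 0 := by omega
      obtain rfl : i = 0 := by omega
      obtain ⟨a, rfl⟩ : ∃ a, g = C a :=
        ⟨_, totalDegree_eq_zero_iff_eq_C.mp (Nat.le_zero.mp hg.totalDegree_le)⟩
      obtain ⟨b, rfl⟩ : ∃ b, h = C b :=
        ⟨_, totalDegree_eq_zero_iff_eq_C.mp (Nat.le_zero.mp hh.totalDegree_le)⟩
      have h1 : L (C a * C b) = a * b * L 1 := by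
        rw [← C_mul, ← mul_one (C (a * b)), ← smul_eq_C_mul, map_smul, smul_eq_mul]
      have h2 : bombieri (C a : MvPolynomial (Fin n) ℝ) (C b) = a * b := by
        rw [C_apply, bombieri_monomial_left]
        simp
      rw [h1, pow_zero, pow_zero, one_mul, one_mul, h2]
      simp
      ring
    have key := degree_mul_map_mul hL g hh
    have h1 : 2 ^ i * (i.factorial : ℝ) * ∑ j, L (pderiv j g * pderiv j h) =
        L 1 * (m * bombieri (normSqPoly n ^ i * g) h) := by
      rcases Nat.eq_zero_or_pos m with rfl | hm
      · simp [pderiv_eq_zero_of_isHomogeneous_zero hg]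
      · rw [Finset.mul_sum, Finset.sum_congr rfl fun j _ => ih (e - 1) (by omega) (m - 1) i _ _
          (by omega) hg.pderiv (hgh.pderiv j) hh.pderiv, ← Finset.mul_sum]
        simp_rw [← bombieri_X_mul, mul_left_comm (X _)]
        rw [← bombieri_sum_left, ← Finset.mul_sum, hg.sum_X_mul_pderiv, mul_smul_comm,
          ← Nat.cast_smul_eq_nsmul ℝ, bombieri_smul_left]
    have h2 : 2 ^ i * (i.factorial : ℝ) * L (g * ∑ j, pderiv j (pderiv j h)) =
        L 1 * (2 * i * bombieri (normSqPoly n ^ i * g) h) := by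
      cases i with
      | zero =>
        rcases Nat.lt_or_ge e 2 with he2 | he2
        · obtain rfl : e = 1 := by omega
          have : ∀ j, pderiv j (pderiv j h) = 0 := fun j =>
            pderiv_eq_zero_of_isHomogeneous_zero hh.pderiv j
          simp [this]
        · rw [map_harmonic_mul_eq_zero hL (e - 2) m g _ (by omega) hg hgh hh.laplacian]
          simp
      | succ i =>
        have := ih (e - 2) (by omega) m i g _ (by omega) hg hgh hh.laplacian
        rw [← bombieri_normSqPoly_mul, ← mul_assoc, ← pow_succ'] at this
        rw [Nat.factorial_succ, pow_succ]
        push_cast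
        linear_combination (2 * ((i : ℝ) + 1)) * this
    have he' : (e : ℝ) ≠ 0 := by exact_mod_cast he.ne'
    have hme : (m : ℝ) + 2 * i = e := by exact_mod_cast hmi
    apply mul_left_cancel₀ he'
    linear_combination 2 ^ i * (i.factorial : ℝ) * key + h1 + h2 +
      L 1 * bombieri (normSqPoly n ^ i * g) h * hme

end GaussianFunctional

section GaussianMoments

open Real

lemma integrable_pow_mul_exp_neg_sq_div_two (k : ℕ) :
    Integrable fun x : ℝ => x ^ k * exp (-(x ^ 2 / 2)) := by
  have := integrable_rpow_mul_exp_neg_mul_sq (b := 1 / 2) (by norm_num) (s := k)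
    (by have : (0 : ℝ) ≤ k := k.cast_nonneg
        linarith)
  simp only [rpow_natCast] at this
  convert this using 4
  ring

lemma integral_pow_succ_mul_exp_neg_sq_div_two (k : ℕ) :
    ∫ x : ℝ, x ^ (k + 1) * exp (-(x ^ 2 / 2)) =
      k * ∫ x : ℝ, x ^ (k - 1) * exp (-(x ^ 2 / 2)) := by
  have hd : ∀ x : ℝ, HasDerivAt (fun x : ℝ => x ^ k * exp (-(x ^ 2 / 2)))
      (k * (x ^ (k - 1) * exp (-(x ^ 2 / 2))) - x ^ (k + 1) * exp (-(x ^ 2 / 2))) x := by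
    intro x
    have h1 : HasDerivAt (fun x : ℝ => -(x ^ 2 / 2)) (-x) x := by
      convert! ((hasDerivAt_pow 2 x).div_const 2).neg using 1
      simp
    convert! (hasDerivAt_pow k x).mul h1.exp using 1
    ring
  have i1 := (integrable_pow_mul_exp_neg_sq_div_two (k - 1)).const_mul (k : ℝ)
  have i2 := integrable_pow_mul_exp_neg_sq_div_two (k + 1)
  have h := integral_eq_zero_of_hasDerivAt_of_integrable hd (i1.sub i2)
    (integrable_pow_mul_exp_neg_sq_div_two k)
  rw [integral_sub i1 i2, integral_const_mul] at h
  linarith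

variable {n : ℕ}

lemma eval_monomial_mul_exp (m : Fin n →₀ ℕ) (a : ℝ) (x : Fin n → ℝ) :
    MvPolynomial.eval x (MvPolynomial.monomial m a) * exp (-((∑ j, x j ^ 2) / 2)) =
      a * ∏ j, (x j ^ m j * exp (-(x j ^ 2 / 2))) := by
  rw [MvPolynomial.eval_monomial, Finset.sum_div, ← Finset.sum_neg_distrib, exp_sum,
    Finset.prod_mul_distrib, Finsupp.prod_fintype _ _ fun _ => pow_zero _, mul_assoc]

lemma integrable_eval_mul_exp (p : MvPolynomial (Fin n) ℝ) :
    Integrable fun x : Fin n → ℝ => MvPolynomial.eval x p * exp (-((∑ j, x j ^ 2) / 2)) := by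
  induction p using MvPolynomial.induction_on' with
  | monomial m a =>
    simp only [eval_monomial_mul_exp]
    exact (Integrable.fintype_prod (f := fun j (y : ℝ) => y ^ m j * exp (-(y ^ 2 / 2)))
      fun j => integrable_pow_mul_exp_neg_sq_div_two (m j)).const_mul a
  | add p q hp hq =>
    simp only [map_add, add_mul]
    exact hp.add hq

/-- Unnormalized integration of polynomials against the standard Gaussian weight. -/
noncomputable def gaussianFunctional (n : ℕ) : MvPolynomial (Fin n) ℝ →ₗ[ℝ] ℝ where
  toFun p := ∫ x : Fin n → ℝ, MvPolynomial.eval x p * exp (-((∑ j, x j ^ 2) / 2))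
  map_add' p q := by
    simp only [map_add, add_mul]
    exact integral_add (integrable_eval_mul_exp p) (integrable_eval_mul_exp q)
  map_smul' c p := by
    simp only [MvPolynomial.smul_eval, mul_assoc, integral_const_mul, RingHom.id_apply, smul_eq_mul]

lemma gaussianFunctional_monomial (m : Fin n →₀ ℕ) (a : ℝ) :
    gaussianFunctional n (MvPolynomial.monomial m a) =
      a * ∏ j, ∫ y : ℝ, y ^ m j * exp (-(y ^ 2 / 2)) := by
  change ∫ x : Fin n → ℝ, _ = _
  simp only [eval_monomial_mul_exp]
  rw [integral_const_mul,
    integral_fintype_prod_volume_eq_prod fun j (y : ℝ) => y ^ m j * exp (-(y ^ 2 / 2))]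

lemma gaussianFunctional_one_pos : 0 < gaussianFunctional n 1 := by
  rw [← MvPolynomial.C_1, MvPolynomial.C_apply, gaussianFunctional_monomial, one_mul]
  refine Finset.prod_pos fun j _ => ?_
  have h := integral_gaussian (1 / 2)
  have h' : ∀ y : ℝ, -(1 / 2) * y ^ 2 = -(y ^ 2 / 2) := fun y => by ring
  simp only [h'] at h
  simp only [Finsupp.coe_zero, Pi.zero_apply, pow_zero, one_mul, h]
  positivity

/-- Gaussian integration by parts. -/
lemma gaussianFunctional_X_mul (j : Fin n) (p : MvPolynomial (Fin n) ℝ) :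
    gaussianFunctional n (MvPolynomial.X j * p) =
      gaussianFunctional n (MvPolynomial.pderiv j p) := by
  induction p using MvPolynomial.induction_on' with
  | monomial m a =>
    rw [MvPolynomial.X, MvPolynomial.monomial_mul, MvPolynomial.pderiv_monomial,
      gaussianFunctional_monomial, gaussianFunctional_monomial,
      ← Finset.mul_prod_erase _ _ (Finset.mem_univ j),
      ← Finset.mul_prod_erase _ (fun i => ∫ y : ℝ, y ^ (m - Finsupp.single j 1 : Fin n →₀ ℕ) i *
        exp (-(y ^ 2 / 2))) (Finset.mem_univ j)]
    have h1 : ∀ i ∈ Finset.univ.erase j, (Finsupp.single j 1 + m : Fin n →₀ ℕ) i =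
        (m - Finsupp.single j 1 : Fin n →₀ ℕ) i := fun i hi => by
      simp [Finsupp.single_eq_of_ne (Finset.ne_of_mem_erase hi)]
    rw [Finset.prod_congr rfl fun i hi => by rw [h1 i hi]]
    simp only [Finsupp.add_apply, Finsupp.tsub_apply, Finsupp.single_eq_same, add_comm 1 (m j),
      integral_pow_succ_mul_exp_neg_sq_div_two]
    ring
  | add p q hp hq => simp only [mul_add, map_add, hp, hq]

end GaussianMoments

section BallIntegrals

open Real Pointwise

variable {n : ℕ}

lemma MvPolynomial.IsHomogeneous.eval_smul {p : MvPolynomial (Fin n) ℝ} {m : ℕ}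
    (hp : p.IsHomogeneous m) (r : ℝ) (x : Fin n → ℝ) :
    MvPolynomial.eval (r • x) p = r ^ m * MvPolynomial.eval x p := by
  rw [MvPolynomial.eval_eq', MvPolynomial.eval_eq', Finset.mul_sum]
  refine Finset.sum_congr rfl fun s hs => ?_
  have hs' : ∑ i, s i = m := by
    have h := hp (MvPolynomial.mem_support_iff.mp hs)
    have h' := congrArg (· s) (Finsupp.degree_eq_weight_one (R := ℕ) (σ := Fin n))
    rw [← h, ← Finsupp.degree_eq_sum]
    exact h'
  simp only [Pi.smul_apply, smul_eq_mul, mul_pow, Finset.prod_mul_distrib,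
    Finset.prod_pow_eq_pow_sum, hs']
  ring

lemma setIntegral_smul_isoBall {p : MvPolynomial (Fin n) ℝ} {m : ℕ}
    (hp : p.IsHomogeneous m) {r : ℝ} (hr : 0 < r) :
    ∫ x in r • isoBall n, MvPolynomial.eval x p =
      r ^ (n + m) * ∫ x in isoBall n, MvPolynomial.eval x p := by
  have h := Measure.setIntegral_comp_smul_of_pos volume
    (fun x : Fin n → ℝ => MvPolynomial.eval x p) (isoBall n) hr
  simp only [hp.eval_smul, integral_const_mul, Module.finrank_fin_fun, smul_eq_mul] at h
  rw [pow_add, mul_assoc, h, mul_inv_cancel_left₀ (by positivity)]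

lemma smul_isoBall {t : ℝ} (ht : 0 < t) :
    √(2 * t / (n + 2)) • isoBall n = {x : Fin n → ℝ | (∑ j, x j ^ 2) / 2 ≤ t} := by
  have hr : 0 < √(2 * t / (n + 2)) := by positivity
  ext x
  rw [Set.mem_smul_set_iff_inv_smul_mem₀ hr.ne']
  simp only [isoBall, Set.mem_ofPred_eq, Pi.smul_apply, smul_eq_mul, mul_pow, ← Finset.mul_sum]
  rw [inv_pow, sq_sqrt (by positivity), inv_mul_le_iff₀ (by positivity),
    div_mul_cancel₀ _ (by positivity), div_le_iff₀' two_pos]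

/-- The ratio between the Gaussian integral and the ball integral of a homogeneous polynomial
of degree `m`. -/
noncomputable def gaussianBallRatio (n m : ℕ) : ℝ :=
  (2 / ((n : ℝ) + 2)) ^ (((n + m : ℕ) : ℝ) / 2) * Gamma (((n + m : ℕ) : ℝ) / 2 + 1)

lemma gaussianBallRatio_pos (n m : ℕ) : 0 < gaussianBallRatio n m :=
  mul_pos (by positivity) (Gamma_pos_of_pos (by positivity))

lemma integral_exp_neg_mul_sqrt_pow (n m : ℕ) :
    ∫ t in Set.Ioi (0 : ℝ), exp (-t) * √(2 * t / (n + 2)) ^ (n + m) = gaussianBallRatio n m := by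
  rw [gaussianBallRatio, Gamma_eq_integral (by positivity), ← integral_const_mul]
  refine setIntegral_congr_fun measurableSet_Ioi fun t ht => ?_
  have ht' : (0 : ℝ) < t := ht
  simp only [add_sub_cancel_right]
  rw [mul_div_right_comm, sqrt_eq_rpow, ← rpow_natCast, ← rpow_mul (by positivity),
    mul_rpow (by positivity) ht'.le, one_div_mul_eq_div]
  ring

lemma integrable_indicator_exp_neg {f : (Fin n → ℝ) → ℝ} (hf : Continuous f)
    (hfi : Integrable fun x => f x * exp (-((∑ j, x j ^ 2) / 2))) :
    Integrable (Function.uncurry fun (x : Fin n → ℝ) (t : ℝ) =>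
      (Set.Ici ((∑ j, x j ^ 2) / 2)).indicator (fun t => f x * exp (-t)) t)
      (volume.prod volume) := by
  have hmeas : AEStronglyMeasurable (Function.uncurry fun (x : Fin n → ℝ) (t : ℝ) =>
      (Set.Ici ((∑ j, x j ^ 2) / 2)).indicator (fun t => f x * exp (-t)) t)
      (volume.prod volume) := by
    have hS : MeasurableSet {z : (Fin n → ℝ) × ℝ | (∑ j, z.1 j ^ 2) / 2 ≤ z.2} :=
      measurableSet_le (by fun_prop) (by fun_prop)
    have hc : Continuous fun z : (Fin n → ℝ) × ℝ => f z.1 * exp (-z.2) := by fun_prop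
    exact (hc.measurable.indicator hS).aestronglyMeasurable
  refine (integrable_prod_iff hmeas).mpr ⟨.of_forall fun x => ?_, ?_⟩
  · refine (integrable_indicator_iff (measurableSet_Ici (a := (∑ j, x j ^ 2) / 2))).mpr ?_
    rw [integrableOn_Ici_iff_integrableOn_Ioi]
    exact Integrable.const_mul (integrableOn_exp_neg_Ioi ((∑ j, x j ^ 2) / 2)) (f x)
  · refine hfi.norm.congr (.of_forall fun x => ?_)
    simp only [Function.uncurry_apply_pair, norm_indicator_eq_indicator_norm]
    rw [integral_indicator measurableSet_Ici, integral_Ici_eq_integral_Ioi]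
    simp only [norm_mul, norm_eq_abs, abs_exp]
    rw [integral_const_mul, integral_exp_neg_Ioi]

lemma gaussianFunctional_eq {p : MvPolynomial (Fin n) ℝ} {m : ℕ} (hp : p.IsHomogeneous m) :
    gaussianFunctional n p =
      gaussianBallRatio n m * ∫ x in isoBall n, MvPolynomial.eval x p := by
  have hpc : Continuous fun x : Fin n → ℝ => MvPolynomial.eval x p :=
    MvPolynomial.continuous_eval p
  have hswap := integral_integral_swap
    (integrable_indicator_exp_neg hpc (integrable_eval_mul_exp p))
  have hleft : ∀ x : Fin n → ℝ, ∫ t, (Set.Ici ((∑ j, x j ^ 2) / 2)).indicator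
      (fun t => MvPolynomial.eval x p * exp (-t)) t =
        MvPolynomial.eval x p * exp (-((∑ j, x j ^ 2) / 2)) := fun x => by
    rw [integral_indicator measurableSet_Ici, integral_Ici_eq_integral_Ioi, integral_const_mul,
      integral_exp_neg_Ioi]
  have hright : ∀ t : ℝ, t ≠ 0 → ∫ x : Fin n → ℝ, (Set.Ici ((∑ j, x j ^ 2) / 2)).indicator
      (fun t => MvPolynomial.eval x p * exp (-t)) t =
        (Set.Ioi (0 : ℝ)).indicator (fun t => exp (-t) * √(2 * t / (n + 2)) ^ (n + m) *
          ∫ x in isoBall n, MvPolynomial.eval x p) t := fun t ht => by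
    rcases ht.lt_or_gt with ht | ht
    · rw [Set.indicator_of_notMem (by simpa using ht.le)]
      refine integral_eq_zero_of_ae (.of_forall fun x => Set.indicator_of_notMem ?_ _)
      have : 0 ≤ (∑ j, x j ^ 2) / 2 := by positivity
      simp only [Set.mem_Ici, not_le]
      linarith
    · rw [Set.indicator_of_mem (Set.mem_Ioi.mpr ht), mul_assoc,
        ← setIntegral_smul_isoBall hp (by positivity),
        smul_isoBall ht, ← integral_const_mul,
        ← integral_indicator (measurableSet_le (by fun_prop) (by fun_prop))]
      refine integral_congr_ae (.of_forall fun x => ?_)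
      simp only [Set.indicator_apply, Set.mem_Ici, Set.mem_ofPred_eq, mul_comm]
  simp only [hleft] at hswap
  rw [integral_congr_ae ((Measure.ae_ne volume (0 : ℝ)).mono hright),
    integral_indicator measurableSet_Ioi, integral_mul_const,
    integral_exp_neg_mul_sqrt_pow] at hswap
  exact hswap

lemma integral_unif_isoBall {p : MvPolynomial (Fin n) ℝ} {m : ℕ} (hp : p.IsHomogeneous m) :
    ∫ x, MvPolynomial.eval x p ∂(unif (isoBall n)) =
      gaussianFunctional n p / gaussianFunctional n 1 *
        (gaussianBallRatio n 0 / gaussianBallRatio n m) := by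
  have h0 := gaussianFunctional_eq (MvPolynomial.isHomogeneous_one (Fin n) ℝ)
  have hm := gaussianFunctional_eq hp
  simp only [map_one, integral_const, smul_eq_mul, mul_one, measureReal_restrict_apply_univ] at h0
  have hpos := gaussianFunctional_one_pos (n := n)
  have hc0 := gaussianBallRatio_pos n 0
  have hcm := gaussianBallRatio_pos n m
  have hv : volume.real (isoBall n) ≠ 0 := by
    intro hv
    rw [hv, mul_zero] at h0
    exact hpos.ne' h0
  rw [unif, integral_smul_measure, ENNReal.toReal_inv, smul_eq_mul, hm, h0, ← Measure.real]
  field_simp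

lemma gaussianBallRatio_two_mul (n d : ℕ) :
    gaussianBallRatio n (2 * d) * ((n : ℝ) + 2) ^ d =
      gaussianBallRatio n 0 * ∏ j ∈ Finset.range d, ((n : ℝ) + 2 * (j + 1)) := by
  induction d with
  | zero => simp
  | succ d ih =>
    have h : gaussianBallRatio n (2 * (d + 1)) * ((n : ℝ) + 2) =
        gaussianBallRatio n (2 * d) * (n + 2 * (d + 1)) := by
      have e : ((n + 2 * (d + 1) : ℕ) : ℝ) / 2 = ((n + 2 * d : ℕ) : ℝ) / 2 + 1 := by
        push_cast
        ring
      rw [gaussianBallRatio, gaussianBallRatio, e, rpow_add_one (by positivity),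
        Gamma_add_one (s := ((n + 2 * d : ℕ) : ℝ) / 2 + 1) (by positivity)]
      push_cast
      field_simp
      ring
    rw [Finset.prod_range_succ, ← mul_assoc, ← ih, pow_succ', ← mul_assoc, h]
    ring

end BallIntegrals

/-- the subspaces `‖x‖^{2i}·H_{d-2i}` are eigenspaces of the covariance of
`X^{⊗d}` for `X` uniform on the isotropic Euclidean ball, with eigenvalue `η_i`, `i < d/2`. -/
theorem stmt15 (n d : ℕ) (hn : 2 ≤ n) (i : ℕ) (hi : 2 * i < d)
    (g : MvPolynomial (Fin n) ℝ)
    (hg : g.IsHomogeneous (d - 2 * i)) (hgh : IsHarmonic g) :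
    ∀ h : MvPolynomial (Fin n) ℝ, h.IsHomogeneous d →
      (∫ x, MvPolynomial.eval x ((∑ j : Fin n, MvPolynomial.X j ^ 2) ^ i * g) *
            MvPolynomial.eval x h ∂(unif (isoBall n))) -
          (∫ x, MvPolynomial.eval x ((∑ j : Fin n, MvPolynomial.X j ^ 2) ^ i * g)
            ∂(unif (isoBall n))) *
          (∫ x, MvPolynomial.eval x h ∂(unif (isoBall n))) =
        (((n : ℝ) + 2) ^ d * ((n : ℝ) / ((n : ℝ) + 2 * d)) *
            ((2 : ℝ) ^ i * (i.factorial : ℝ) *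
              ∏ j ∈ Finset.range (d - i), ((n : ℝ) + 2 * j))⁻¹) *
          bombieri ((∑ j : Fin n, MvPolynomial.X j ^ 2) ^ i * g) h := by
  intro h hh
  have hL := gaussianFunctional_X_mul (n := n)
  have hq : (normSqPoly n ^ i * g).IsHomogeneous d := by
    have := (isHomogeneous_normSqPoly (n := n)).pow i |>.mul hg
    rwa [Nat.add_sub_cancel' hi.le] at this
  have hmean : ∫ x, MvPolynomial.eval x (normSqPoly n ^ i * g) ∂(unif (isoBall n)) = 0 := by
    have h0 : gaussianFunctional n g = 0 := by
      simpa using map_harmonic_mul_eq_zero hL 0 (d - 2 * i) g 1 (by omega) hg hgh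
        (MvPolynomial.isHomogeneous_one _ _)
    rw [integral_unif_isoBall hq, map_normSqPoly_pow_mul hL hg, h0]
    simp
  have hgd : (g * h).IsHomogeneous (2 * (d - i)) := by
    have := hg.mul hh
    rwa [show d - 2 * i + d = 2 * (d - i) by omega] at this
  have hfh : (normSqPoly n ^ i * (g * h)).IsHomogeneous (2 * d) := by
    have := hq.mul hh
    rwa [mul_assoc, ← two_mul] at this
  rw [hmean, zero_mul, sub_zero]
  simp only [← map_mul]
  rw [mul_assoc, integral_unif_isoBall hfh, map_normSqPoly_pow_mul hL hgd]
  have hC := map_harmonic_mul hL d (d - 2 * i) i g h (by omega) hg hgh hh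
  have hratio := gaussianBallRatio_two_mul n d
  have hn0 : (0 : ℝ) < n := by exact_mod_cast (by omega : 0 < n)
  have hprod : (∏ j ∈ Finset.range d, ((n : ℝ) + 2 * (j + 1))) * n =
      (∏ j ∈ Finset.range (d - i), ((n : ℝ) + 2 * j)) *
        (∏ k ∈ Finset.range i, ((n : ℝ) + ((2 * (d - i) : ℕ) + 2 * k))) * (n + 2 * d) := by
    have h1 := Finset.prod_range_succ' (fun j : ℕ => (n : ℝ) + 2 * j) d
    rw [Finset.prod_range_succ] at h1
    have h2 := Finset.prod_range_add (fun j : ℕ => (n : ℝ) + 2 * j) (d - i) i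
    rw [Nat.sub_add_cancel (by omega)] at h2
    rw [h2] at h1
    push_cast at h1 ⊢
    simp only [mul_zero, add_zero, mul_add (2 : ℝ)] at h1 ⊢
    exact h1.symm
  have hA : (0 : ℝ) < ∏ j ∈ Finset.range (d - i), ((n : ℝ) + 2 * j) :=
    Finset.prod_pos fun j _ => by positivity
  have hLpos := gaussianFunctional_one_pos (n := n)
  have hc0 := gaussianBallRatio_pos n 0
  have hcd := gaussianBallRatio_pos n (2 * d)
  have hB : bombieri (normSqPoly n ^ i * g) h =
      2 ^ i * (i.factorial : ℝ) * gaussianFunctional n (g * h) / gaussianFunctional n 1 := by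
    rw [hC]
    field_simp
  have hR : ((n : ℝ) + 2) ^ d = gaussianBallRatio n 0 *
      (∏ j ∈ Finset.range d, ((n : ℝ) + 2 * (j + 1))) / gaussianBallRatio n (2 * d) := by
    rw [← hratio]
    field_simp
  have hP : (∏ j ∈ Finset.range d, ((n : ℝ) + 2 * (j + 1))) =
      (∏ j ∈ Finset.range (d - i), ((n : ℝ) + 2 * j)) *
        (∏ k ∈ Finset.range i, ((n : ℝ) + ((2 * (d - i) : ℕ) + 2 * k))) * (n + 2 * d) / n := by
    rw [← hprod]
    field_simp
  rw [hB, hR, hP]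
  have hi0 : (0 : ℝ) < i.factorial := by exact_mod_cast i.factorial_pos
  have hnd : (0 : ℝ) < n + 2 * d := by positivity
  field_simp
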